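/- For the one-way coupled OU system above, the steady-state entropy production rate Φ = −tr(C D⁻¹ C Σ⁻¹), where C = MΣ + D is the antisymmetric irreversibility matrix and Σ solves MΣ + ΣMᵀ + 2D = 0, equals exactly α₂ λ² for all λ, with α₂ = u₁² D_f / (D₁(γ₁ + γ_f)) + u₂² D_f / (D₂(γ₂ + γ_f)) > 0. -/

import Mathlib

/-- A symmetric solution of the Lyapunov equation with positive definite noise is invertible. -/
theorem isUnit_det_of_lyapunov {n : Type*} [Fintype n] [DecidableEq n] {M D S : Matrix n n ℝ}
    (hD : D.PosDef) (hS : S.transpose = S)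
    (h : M * S + S * M.transpose + (2 : ℝ) • D = 0) : IsUnit S.det := by
  rw [isUnit_iff_ne_zero]
  intro hdet
  obtain ⟨w, hw, hSw⟩ := Matrix.exists_mulVec_eq_zero_iff.mpr hdet
  have hwS : Matrix.vecMul w S = 0 := by rw [← Matrix.mulVec_transpose, hS, hSw]
  have hq := congrArg (fun A => w ⬝ᵥ Matrix.mulVec A w) h
  simp only [Matrix.add_mulVec, ← Matrix.mulVec_mulVec, hSw, Matrix.mulVec_zero, dotProduct_add,
    dotProduct_zero, Matrix.dotProduct_mulVec w S, hwS, zero_dotProduct, Matrix.smul_mulVec,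
    dotProduct_smul, Matrix.zero_mulVec, smul_eq_mul] at hq
  have hpos := hD.dotProduct_mulVec_pos hw
  simp only [star_trivial] at hpos
  linarith

/-- The entropy production trace of a stationary covariance, without the inverse covariance. -/
theorem trace_irreversibility_eq {n : Type*} [Fintype n] [DecidableEq n] {M D S : Matrix n n ℝ}
    (hD : IsUnit D.det) (hS : IsUnit S.det)
    (h : M * S + S * M.transpose + (2 : ℝ) • D = 0) :
    ((M * S + D) * D⁻¹ * (M * S + D) * S⁻¹).trace = (M * S * D⁻¹ * M).trace + M.trace := by
  have hDS : (D * S⁻¹).trace = -M.trace := by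
    have ht := congrArg (fun A => (A * S⁻¹).trace) h
    simp only [add_mul, Matrix.trace_add, Matrix.mul_nonsing_inv_cancel_right _ _ hS,
      Matrix.smul_mul, Matrix.trace_smul, Matrix.zero_mul, Matrix.trace_zero, smul_eq_mul] at ht
    rw [Matrix.trace_mul_comm (S * M.transpose), Matrix.nonsing_inv_mul_cancel_left _ _ hS,
      Matrix.trace_transpose] at ht
    linarith
  have hexp : (M * S + D) * D⁻¹ * (M * S + D) * S⁻¹ = M * S * D⁻¹ * M + M + M + D * S⁻¹ := by
    have h₁ : (M * S + D) * D⁻¹ = M * S * D⁻¹ + 1 := by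
      rw [add_mul, Matrix.mul_nonsing_inv _ hD]
    have h₂ : (M * S + D) * S⁻¹ = M + D * S⁻¹ := by
      rw [add_mul, Matrix.mul_nonsing_inv_cancel_right _ _ hS]
    rw [mul_assoc, h₁, h₂, add_mul, mul_add, one_mul, ← mul_assoc (M * S * D⁻¹) D,
      Matrix.nonsing_inv_mul_cancel_right _ _ hD, Matrix.mul_nonsing_inv_cancel_right _ _ hS]
    abel
  rw [hexp]
  simp only [Matrix.trace_add, hDS]
  ring

theorem epr_exact_quadratic (γ₁ γ₂ γf D₁ D₂ Df lam u₁ u₂ : ℝ)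
    (hγ₁ : 0 < γ₁) (hγ₂ : 0 < γ₂) (hγf : 0 < γf)
    (hD₁ : 0 < D₁) (hD₂ : 0 < D₂) (hDf : 0 < Df)
    (hu : u₁ ^ 2 + u₂ ^ 2 = 1)
    (M D Sig : Matrix (Fin 3) (Fin 3) ℝ)
    (hM : M = Matrix.of ![![-γ₁, 0, lam * u₁], ![0, -γ₂, lam * u₂], ![0, 0, -γf]])
    (hD : D = Matrix.diagonal ![D₁, D₂, Df])
    (hSig : M * Sig + Sig * M.transpose + (2 : ℝ) • D = 0) :
    let C : Matrix (Fin 3) (Fin 3) ℝ := M * Sig + D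
    (-((C * D⁻¹ * C * Sig⁻¹).trace)
        = (u₁ ^ 2 * Df / (D₁ * (γ₁ + γf)) + u₂ ^ 2 * Df / (D₂ * (γ₂ + γf))) * lam ^ 2)
      ∧ 0 < u₁ ^ 2 * Df / (D₁ * (γ₁ + γf)) + u₂ ^ 2 * Df / (D₂ * (γ₂ + γf)) := by
  have hpd : D.PosDef := by
    rw [hD, Matrix.posDef_diagonal_iff]
    intro i
    fin_cases i <;> simpa
  have hDu : IsUnit D.det := hpd.det_pos.ne'.isUnit
  have hent : ∀ i j, (M * Sig + Sig * M.transpose + (2 : ℝ) • D) i j = 0 := fun i j => by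
    rw [hSig]; rfl
  have h00 := hent 0 0
  have h01 := hent 0 1
  have h02 := hent 0 2
  have h10 := hent 1 0
  have h11 := hent 1 1
  have h12 := hent 1 2
  have h20 := hent 2 0
  have h21 := hent 2 1
  have h22 := hent 2 2
  simp [hM, hD, Matrix.mul_apply, Matrix.vecMul, dotProduct, Fin.sum_univ_three]
    at h00 h01 h02 h10 h11 h12 h20 h21 h22
  have e22 : Sig 2 2 = Df / γf := by
    rw [eq_div_iff hγf.ne']; linarith
  have e02 : Sig 0 2 = lam * u₁ * Sig 2 2 / (γ₁ + γf) := by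
    rw [eq_div_iff (by positivity)]; linarith
  have e20 : Sig 2 0 = lam * u₁ * Sig 2 2 / (γ₁ + γf) := by
    rw [eq_div_iff (by positivity)]; linarith
  have e12 : Sig 1 2 = lam * u₂ * Sig 2 2 / (γ₂ + γf) := by
    rw [eq_div_iff (by positivity)]; linarith
  have e21 : Sig 2 1 = lam * u₂ * Sig 2 2 / (γ₂ + γf) := by
    rw [eq_div_iff (by positivity)]; linarith
  have s02 : Sig 0 2 = Sig 2 0 := e02.trans e20.symm
  have s12 : Sig 1 2 = Sig 2 1 := e12.trans e21.symm
  have s01 : Sig 0 1 = Sig 1 0 := by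
    rw [s02] at h01
    rw [s12] at h10
    have hne : γ₁ + γ₂ ≠ 0 := by positivity
    apply mul_left_cancel₀ hne
    linarith
  have hsymm : Sig.transpose = Sig := by
    ext i j
    fin_cases i <;> fin_cases j <;> simp [s01, s02, s12]
  have e00 : Sig 0 0 = (D₁ + lam * u₁ * Sig 2 0) / γ₁ := by
    rw [s02] at h00
    rw [eq_div_iff hγ₁.ne']; linarith
  have e11 : Sig 1 1 = (D₂ + lam * u₂ * Sig 2 1) / γ₂ := by
    rw [s12] at h11
    rw [eq_div_iff hγ₂.ne']; linarith
  have hDinv : D⁻¹ = Matrix.diagonal ![D₁⁻¹, D₂⁻¹, Df⁻¹] := by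
    apply Matrix.inv_eq_right_inv
    rw [hD, Matrix.diagonal_mul_diagonal, ← Matrix.diagonal_one]
    congr 1
    ext i
    fin_cases i <;> simp [hD₁.ne', hD₂.ne', hDf.ne']
  intro C
  refine ⟨?_, ?_⟩
  · rw [trace_irreversibility_eq hDu (isUnit_det_of_lyapunov hpd hsymm hSig) hSig,
      Matrix.trace_mul_comm, hDinv, hM]
    simp [Matrix.trace, Matrix.mul_apply, Matrix.vecMul, dotProduct, Fin.sum_univ_three,
      Matrix.diagonal_apply]
    rw [e00, e11, e20, e21, e22]
    field_simp
    ring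
  · by_cases h : u₁ = 0
    · have h₂ : 0 < u₂ ^ 2 := by rw [h] at hu; linarith
      positivity
    · positivity
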